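/- arXiv:2511.20519 — 2 statements merged into one kernel-verified Lean document; each statement's English description precedes it below -/
import Mathlib

section
/- Let (d_n, k_n) be a sequence of admissible dimension pairs with d_n → ∞. Suppose either (i) k_n/d_n → 1/2 and liminf_{n→∞} d_n^{-1} (2k_n - d_n - 1)^{d_n/k_n} > eπ, or (ii) liminf_{n→∞} k_n/d_n > 1/2. For each n let μ_n be a probability measure on ℝ whose characteristic function is φ_n(t) = exp( ∫_0^1 ( e^{i t x/σ_{d_n,k_n}} − 1 − i t x/σ_{d_n,k_n} ) f_{d_n,k_n}(x) dx ) for all t ∈ ℝ. Then μ_n converges weakly to the Dirac measure at 0 as n → ∞. -/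
open MeasureTheory ProbabilityTheory Filter

/-- The characteristic function of a measure on `ℝ`. -/
noncomputable def charFn (μ : Measure ℝ) (t : ℝ) : ℂ :=
  ∫ x, Complex.exp (Complex.I * t * x) ∂μ

/-- The Lévy density `f_{d,k}(x) = (ω_{d−k}/(k−1)) x^{−1−(d−1)/(k−1)} (1−x^{2/(k−1)})^{(d−k)/2−1}`
on `(0,1)`, where `ω_b = 2π^{b/2}/Γ(b/2)`. -/
noncomputable def levyDensity (d k : ℕ) (x : ℝ) : ℝ :=
  2 * Real.pi ^ (((d : ℝ) - k) / 2) / Real.Gamma (((d : ℝ) - k) / 2) / ((k : ℝ) - 1) *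
    x ^ (-1 - ((d : ℝ) - 1) / ((k : ℝ) - 1)) *
    (1 - x ^ (2 / ((k : ℝ) - 1))) ^ (((d : ℝ) - k) / 2 - 1)

/-- The variance `σ_{d,k}² = ∫_0^1 x² f_{d,k}(x) dx` of the limit random variable `Z_{d,k}`. -/
noncomputable def sigmaSqHyp (d k : ℕ) : ℝ :=
  ∫ x in Set.Ioo (0 : ℝ) 1, x ^ 2 * levyDensity d k x

/-- `σ_{d,k} = (σ_{d,k}²)^{1/2}`. -/
noncomputable def sigmaHyp (d k : ℕ) : ℝ :=
  Real.sqrt (sigmaSqHyp d k)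

/-- The integral of the real density of the beta distribution is one. -/
theorem integral_betaPDFReal_eq_one {p q : ℝ} (hp : 0 < p) (hq : 0 < q) :
    ∫ x in Set.Ioi (0 : ℝ), betaPDFReal p q x = 1 := by
  have hnonneg : ∀ x, 0 ≤ betaPDFReal p q x := fun x ↦ by
    by_cases hx : 0 < x ∧ x < 1
    · exact (betaPDFReal_pos hx.1 hx.2 hp hq).le
    · simp [betaPDFReal, hx]
  have hfull : ∫ x, betaPDFReal p q x = 1 := by
    rw [integral_eq_lintegral_of_nonneg_ae (ae_of_all _ hnonneg)
      (stronglyMeasurable_betaPDFReal p q).aestronglyMeasurable]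
    have := lintegral_betaPDF_eq_one hp hq
    simp only [betaPDF] at this
    simp [this]
  rw [← hfull]
  refine setIntegral_eq_integral_of_forall_compl_eq_zero fun x hx ↦ ?_
  have hx' : ¬ (0 < x ∧ x < 1) := fun h ↦ hx h.1
  simp [betaPDFReal, hx']

theorem integral_rpow_mul_levyDensity {d k : ℕ} (hk : 1 < k) (hkd : k < d) {y : ℝ}
    (hy : 0 < (2 * (k : ℝ) - d - 1) / 2 - y) :
    ∫ x in Set.Ioo (0 : ℝ) 1, x ^ (2 - 2 * y / ((k : ℝ) - 1)) * levyDensity d k x =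
      Real.pi ^ (((d : ℝ) - k) / 2) * Real.Gamma ((2 * (k : ℝ) - d - 1) / 2 - y) /
        Real.Gamma (((k : ℝ) - 1) / 2 - y) := by
  have hk' : (1 : ℝ) < k := by exact_mod_cast hk
  have hkd' : (k : ℝ) < d := by exact_mod_cast hkd
  obtain ⟨m, hm⟩ : ∃ m : ℝ, m = (k : ℝ) - 1 := ⟨_, rfl⟩
  obtain ⟨q, hq⟩ : ∃ q : ℝ, q = ((d : ℝ) - k) / 2 := ⟨_, rfl⟩
  obtain ⟨p, hp⟩ : ∃ p : ℝ, p = (2 * (k : ℝ) - d - 1) / 2 - y := ⟨_, rfl⟩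
  have hm0 : 0 < m := by linarith
  have hq0 : 0 < q := by linarith
  have hp0 : 0 < p := hp ▸ hy
  have hc0 : 0 < 2 / m := by positivity
  have hsum : ((k : ℝ) - 1) / 2 - y = p + q := by rw [hp, hq]; ring
  have hbeta := beta_pos hp0 hq0
  have hGq := Real.Gamma_pos_of_pos hq0
  have hsub := integral_comp_rpow_Ioi_of_pos (g := betaPDFReal p q) hc0
  rw [integral_betaPDFReal_eq_one hp0 hq0] at hsub
  have hres : ∫ x in Set.Ioo (0 : ℝ) 1, (2 / m * x ^ (2 / m - 1)) • betaPDFReal p q (x ^ (2 / m))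
      = 1 := by
    refine Eq.trans (Eq.symm ?_) hsub
    refine setIntegral_eq_of_subset_of_forall_sdiff_eq_zero measurableSet_Ioi
      Set.Ioo_subset_Ioi_self fun x hx ↦ ?_
    have hx0 : 0 < x := hx.1
    have hx1 : 1 ≤ x := by
      by_contra! h
      exact hx.2 ⟨hx0, h⟩
    have : ¬ (0 < x ^ (2 / m) ∧ x ^ (2 / m) < 1) := fun h ↦
      absurd h.2 (not_lt.2 (Real.one_le_rpow hx1 hc0.le))
    simp [betaPDFReal, this]
  have hcongr : ∫ x in Set.Ioo (0 : ℝ) 1, x ^ (2 - 2 * y / ((k : ℝ) - 1)) * levyDensity d k x =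
      ∫ x in Set.Ioo (0 : ℝ) 1, Real.pi ^ q / Real.Gamma q * beta p q *
        ((2 / m * x ^ (2 / m - 1)) • betaPDFReal p q (x ^ (2 / m))) := by
    refine setIntegral_congr_fun measurableSet_Ioo fun x hx ↦ ?_
    have hx0 : 0 < x := hx.1
    have hcond : 0 < x ^ (2 / m) ∧ x ^ (2 / m) < 1 :=
      ⟨by positivity, Real.rpow_lt_one hx0.le hx.2 hc0⟩
    have hpow : x ^ (2 - 2 * y / m) * x ^ (-1 - ((d : ℝ) - 1) / m) =
        x ^ (2 / m - 1) * (x ^ (2 / m)) ^ (p - 1) := by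
      rw [← Real.rpow_mul hx0.le, ← Real.rpow_add hx0, ← Real.rpow_add hx0]
      congr 1
      have : (d : ℝ) = 2 * m + 1 - 2 * y - 2 * p := by rw [hp, hm]; ring
      rw [this]
      field_simp
      ring
    simp only [levyDensity, betaPDFReal, hcond, and_self, if_true, smul_eq_mul, ← hm, ← hq]
    calc _ = (2 * Real.pi ^ q / Real.Gamma q / m) *
          (x ^ (2 - 2 * y / m) * x ^ (-1 - ((d : ℝ) - 1) / m)) *
            (1 - x ^ (2 / m)) ^ (q - 1) := by ring
      _ = _ := by
        rw [hpow]
        field_simp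
  rw [hcongr, integral_const_mul, hres, hsum, ← hp, ← hq, beta]
  field_simp

theorem integrableOn_rpow_mul_levyDensity {d k : ℕ} (hk : 1 < k) (hkd : k < d) {y : ℝ}
    (hy : 0 < (2 * (k : ℝ) - d - 1) / 2 - y) :
    IntegrableOn (fun x ↦ x ^ (2 - 2 * y / ((k : ℝ) - 1)) * levyDensity d k x)
      (Set.Ioo (0 : ℝ) 1) := by
  have hkd' : (k : ℝ) < d := by exact_mod_cast hkd
  by_contra h
  have h0 := integral_rpow_mul_levyDensity hk hkd hy
  rw [integral_undef h] at h0
  have h1 := Real.Gamma_pos_of_pos hy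
  have h2 : 0 < Real.Gamma (((k : ℝ) - 1) / 2 - y) := Real.Gamma_pos_of_pos (by linarith)
  have : 0 < Real.pi ^ (((d : ℝ) - k) / 2) * Real.Gamma ((2 * (k : ℝ) - d - 1) / 2 - y) /
        Real.Gamma (((k : ℝ) - 1) / 2 - y) := by positivity
  exact this.ne h0

theorem levyDensity_nonneg {d k : ℕ} (hk : 1 < k) (hkd : k < d) {x : ℝ}
    (hx : x ∈ Set.Ioo (0 : ℝ) 1) : 0 ≤ levyDensity d k x := by
  have hk' : (0 : ℝ) < k - 1 := sub_pos.2 (by exact_mod_cast hk)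
  have hkd' : (0 : ℝ) < ((d : ℝ) - k) / 2 := half_pos (sub_pos.2 (by exact_mod_cast hkd))
  have hG := Real.Gamma_pos_of_pos hkd'
  have hx0 := hx.1
  have h1 : 0 ≤ 1 - x ^ (2 / ((k : ℝ) - 1)) :=
    sub_nonneg.2 (Real.rpow_le_one hx0.le hx.2.le (by positivity))
  have := Real.pi_pos
  unfold levyDensity
  positivity

theorem sigmaSqHyp_eq {d k : ℕ} (hk : 1 < k) (hkd : k < d) (h : d + 1 < 2 * k) :
    sigmaSqHyp d k = Real.pi ^ (((d : ℝ) - k) / 2) *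
      Real.Gamma ((2 * (k : ℝ) - d - 1) / 2) / Real.Gamma (((k : ℝ) - 1) / 2) := by
  have h' : (d : ℝ) + 1 < 2 * k := by exact_mod_cast h
  have := integral_rpow_mul_levyDensity hk hkd (y := 0) (by linarith)
  simpa [sigmaSqHyp] using this

theorem sigmaSqHyp_pos {d k : ℕ} (hk : 1 < k) (hkd : k < d) (h : d + 1 < 2 * k) :
    0 < sigmaSqHyp d k := by
  have h' : (d : ℝ) + 1 < 2 * k := by exact_mod_cast h
  have hk' : (1 : ℝ) < k := by exact_mod_cast hk
  rw [sigmaSqHyp_eq hk hkd h]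
  have h1 := Real.Gamma_pos_of_pos (s := (2 * (k : ℝ) - d - 1) / 2) (by linarith)
  have h2 := Real.Gamma_pos_of_pos (s := ((k : ℝ) - 1) / 2) (by linarith)
  have := Real.pi_pos
  positivity

theorem norm_exp_I_mul_sub_one_sub_le {y r : ℝ} (h1 : 1 ≤ r) (h2 : r ≤ 2) :
    ‖Complex.exp (Complex.I * y) - 1 - Complex.I * y‖ ≤ 2 * |y| ^ r := by
  have hnorm : ‖Complex.I * (y : ℂ)‖ = |y| := by simp
  rcases le_total |y| 1 with hy | hy
  · refine (Complex.norm_exp_sub_one_sub_id_le (by rw [hnorm]; exact hy)).trans ?_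
    rw [hnorm, ← Real.rpow_two]
    rcases eq_or_ne y 0 with rfl | h0
    · simp only [abs_zero]
      rw [Real.zero_rpow (by norm_num), Real.zero_rpow (by linarith)]
      norm_num
    · have := Real.rpow_le_rpow_of_exponent_ge (abs_pos.2 h0) hy h2
      have := Real.rpow_nonneg (abs_nonneg y) r
      linarith
  · have h3 : |y| ≤ |y| ^ r := by
      simpa using Real.rpow_le_rpow_of_exponent_le hy h1
    calc _ ≤ ‖Complex.exp (Complex.I * y) - 1‖ + ‖Complex.I * (y : ℂ)‖ := norm_sub_le _ _
      _ ≤ |y| + |y| := by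
        rw [hnorm]
        gcongr
        exact Real.norm_exp_I_mul_ofReal_sub_one_le
      _ ≤ _ := by linarith

theorem Gamma_mul_Gamma_add_nat_le {x z : ℝ} (hx : 0 < x) (hxz : x ≤ z) (j : ℕ) :
    Real.Gamma x * Real.Gamma (z + j) ≤ (z / x) ^ j * (Real.Gamma (x + j) * Real.Gamma z) := by
  have hz : 0 < z := hx.trans_le hxz
  induction j with
  | zero => simp
  | succ j ih =>
    have hxj : 0 < x + j := by positivity
    have hzj : 0 < z + j := by positivity
    have h1 : Real.Gamma (z + (j + 1 : ℕ)) = (z + j) * Real.Gamma (z + j) := by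
      rw [← Real.Gamma_add_one hzj.ne']; push_cast; ring_nf
    have h2 : Real.Gamma (x + (j + 1 : ℕ)) = (x + j) * Real.Gamma (x + j) := by
      rw [← Real.Gamma_add_one hxj.ne']; push_cast; ring_nf
    have h3 : z + j ≤ z / x * (x + j) := by
      rw [div_mul_eq_mul_div, le_div_iff₀ hx]
      nlinarith [(Nat.cast_nonneg j : (0 : ℝ) ≤ j)]
    have := Real.Gamma_pos_of_pos hx
    have := Real.Gamma_pos_of_pos hzj
    rw [h1, h2]
    calc _ = (z + j) * (Real.Gamma x * Real.Gamma (z + j)) := by ring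
      _ ≤ (z / x * (x + j)) * ((z / x) ^ j * (Real.Gamma (x + j) * Real.Gamma z)) := by
        gcongr
      _ = _ := by ring

/-- The bound on the size of the characteristic exponent obtained from the moment of order
`2 - 2j/(k-1)` of the Lévy measure. -/
noncomputable def exponentBound (d k j : ℕ) : ℝ :=
  ((((k : ℝ) - 1) / 2 - j) / ((2 * (k : ℝ) - d - 1) / 2 - j)) ^ j *
    sigmaSqHyp d k ^ ((j : ℝ) / ((k : ℝ) - 1))

theorem sigmaHyp_rpow_mul_integral_le {d k j : ℕ} (hk : 1 < k) (hkd : k < d)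
    (h : d + 1 < 2 * k) (hj : (j : ℝ) < (2 * (k : ℝ) - d - 1) / 2) :
    (sigmaHyp d k)⁻¹ ^ (2 - 2 * (j : ℝ) / ((k : ℝ) - 1)) *
      ∫ x in Set.Ioo (0 : ℝ) 1, x ^ (2 - 2 * (j : ℝ) / ((k : ℝ) - 1)) * levyDensity d k x ≤
      exponentBound d k j := by
  have hS := sigmaSqHyp_pos hk hkd h
  have hSeq := sigmaSqHyp_eq hk hkd h
  have hk' : (1 : ℝ) < k := by exact_mod_cast hk
  have hkd' : (k : ℝ) < d := by exact_mod_cast hkd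
  have hx : 0 < (2 * (k : ℝ) - d - 1) / 2 - j := by linarith
  have hpow : (sigmaHyp d k)⁻¹ ^ (2 - 2 * (j : ℝ) / ((k : ℝ) - 1)) =
      sigmaSqHyp d k ^ ((j : ℝ) / ((k : ℝ) - 1)) * (sigmaSqHyp d k)⁻¹ := by
    rw [sigmaHyp, Real.sqrt_eq_rpow, ← Real.rpow_neg hS.le, ← Real.rpow_mul hS.le,
      ← Real.rpow_neg_one (sigmaSqHyp d k), ← Real.rpow_add hS]
    congr 1
    ring
  rw [hpow, integral_rpow_mul_levyDensity hk hkd hx, exponentBound, mul_comm (_ ^ j), mul_assoc]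
  gcongr
  have hz : (2 * (k : ℝ) - d - 1) / 2 - j ≤ ((k : ℝ) - 1) / 2 - j := by linarith
  have hG := Gamma_mul_Gamma_add_nat_le hx hz j
  rw [sub_add_cancel, sub_add_cancel] at hG
  have h1 := Real.Gamma_pos_of_pos (s := (2 * (k : ℝ) - d - 1) / 2) (by linarith)
  have h2 := Real.Gamma_pos_of_pos (s := ((k : ℝ) - 1) / 2) (by linarith)
  have h3 := Real.Gamma_pos_of_pos (hx.trans_le hz)
  have hpi : 0 < Real.pi ^ (((d : ℝ) - k) / 2) := by have := Real.pi_pos; positivity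
  calc _ = (Real.Gamma ((2 * (k : ℝ) - d - 1) / 2 - j) * Real.Gamma (((k : ℝ) - 1) / 2)) /
        (Real.Gamma ((2 * (k : ℝ) - d - 1) / 2) * Real.Gamma (((k : ℝ) - 1) / 2 - j)) := by
        rw [hSeq]; field_simp
    _ ≤ _ := by
        rw [div_le_iff₀ (by positivity)]
        exact hG

theorem norm_characteristicExponent_le {d k j : ℕ} (hk : 1 < k) (hkd : k < d)
    (h : d + 1 < 2 * k) (hj : (j : ℝ) < (2 * (k : ℝ) - d - 1) / 2) (t : ℝ) :
    ‖∫ x in Set.Ioo (0 : ℝ) 1,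
        (Complex.exp (Complex.I * t * (x / sigmaHyp d k)) - 1 -
            Complex.I * t * (x / sigmaHyp d k)) * (levyDensity d k x : ℂ)‖ ≤
      2 * (1 + |t|) ^ 2 * exponentBound d k j := by
  have hk' : (1 : ℝ) < k := by exact_mod_cast hk
  have hkd' : (k : ℝ) < d := by exact_mod_cast hkd
  have hσ : 0 < sigmaHyp d k := Real.sqrt_pos.2 (sigmaSqHyp_pos hk hkd h)
  obtain ⟨r, hr⟩ : ∃ r : ℝ, r = 2 - 2 * (j : ℝ) / ((k : ℝ) - 1) := ⟨_, rfl⟩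
  have hle : 2 * (j : ℝ) / ((k : ℝ) - 1) ≤ 1 := by
    rw [div_le_one (by linarith)]; linarith
  have hr1 : 1 ≤ r := by linarith
  have hr2 : r ≤ 2 := by
    have : 0 ≤ 2 * (j : ℝ) / ((k : ℝ) - 1) := div_nonneg (by positivity) (by linarith)
    linarith
  have ht : |t| ^ r ≤ (1 + |t|) ^ 2 := by
    rw [← Real.rpow_two]
    exact (Real.rpow_le_rpow (abs_nonneg t) (by linarith) (by linarith)).trans
      (Real.rpow_le_rpow_of_exponent_le (by linarith [abs_nonneg t]) hr2)
  have hint := integrableOn_rpow_mul_levyDensity hk hkd (sub_pos.2 hj)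
  have hI := sigmaHyp_rpow_mul_integral_le hk hkd h hj
  rw [← hr] at hint hI
  refine (norm_integral_le_of_norm_le
    (hint.const_mul (2 * (1 + |t|) ^ 2 * (sigmaHyp d k)⁻¹ ^ r)) ?_).trans ?_
  · refine (ae_restrict_iff' measurableSet_Ioo).2 (ae_of_all _ fun x hx ↦ ?_)
    have hx0 : 0 < x := hx.1
    have hf := levyDensity_nonneg hk hkd hx
    have hb := norm_exp_I_mul_sub_one_sub_le (y := t * (x / sigmaHyp d k)) hr1 hr2
    rw [abs_mul, abs_of_pos (div_pos hx0 hσ), Real.mul_rpow (abs_nonneg _) (by positivity),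
      div_eq_mul_inv x, Real.mul_rpow hx0.le (by positivity)] at hb
    push_cast at hb
    rw [norm_mul, Complex.norm_real, Real.norm_of_nonneg hf, mul_assoc Complex.I,
      div_eq_mul_inv (x : ℂ)]
    calc _ ≤ 2 * (|t| ^ r * (x ^ r * (sigmaHyp d k)⁻¹ ^ r)) * levyDensity d k x := by gcongr
      _ ≤ 2 * ((1 + |t|) ^ 2 * (x ^ r * (sigmaHyp d k)⁻¹ ^ r)) * levyDensity d k x := by gcongr
      _ = _ := by ring
  · rw [integral_const_mul, mul_assoc _ (_ ^ r)]
    gcongr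

theorem Real.log_Gamma_add_one {x : ℝ} (hx : 0 < x) :
    Real.log (Real.Gamma (x + 1)) = Real.log x + Real.log (Real.Gamma x) := by
  rw [Real.Gamma_add_one hx.ne', Real.log_mul hx.ne' (Real.Gamma_pos_of_pos hx).ne']

theorem Real.log_Gamma_add_mul_log_le {x y : ℝ} (hx : 1 < x) (hy : 0 < y) :
    Real.log (Real.Gamma x) + y * Real.log (x - 1) ≤ Real.log (Real.Gamma (x + y)) := by
  have h := Real.convexOn_log_Gamma.slope_mono_adjacent (x := x - 1) (y := x) (z := x + y)
    (Set.mem_Ioi.2 (by linarith)) (Set.mem_Ioi.2 (by linarith)) (by linarith) (by linarith)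
  have h1 := Real.log_Gamma_add_one (x := x - 1) (by linarith)
  rw [sub_add_cancel] at h1
  simp only [Function.comp_apply, sub_sub_cancel, div_one, add_sub_cancel_left] at h
  rw [le_div_iff₀ hy, h1] at h
  linarith

theorem Real.log_Gamma_le_mul_log {x : ℝ} (hx : 1 ≤ x) :
    Real.log (Real.Gamma x) ≤ x * Real.log x := by
  rcases hx.eq_or_lt with rfl | hx
  · simp
  have h := Real.convexOn_log_Gamma.slope_mono_adjacent (x := 1) (y := x) (z := x + 1)
    (Set.mem_Ioi.2 (by linarith)) (Set.mem_Ioi.2 (by linarith)) hx (by linarith)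
  have h1 := Real.log_Gamma_add_one (x := x) (by linarith)
  simp only [Function.comp_apply, h1, Real.Gamma_one, Real.log_one, add_sub_cancel_right,
    add_sub_cancel_left, div_one, sub_zero] at h
  rw [div_le_iff₀ (by linarith)] at h
  nlinarith [Real.log_nonneg hx.le]

theorem Real.mul_log_sub_le_log_Gamma_add_one {z : ℝ} (hz : 0 < z) :
    z * Real.log z - z ≤ Real.log (Real.Gamma (z + 1)) := by
  have hconv := Real.GammaIntegral_convergent (s := z + 1) (by linarith)
  have key : z ^ z * Real.exp (-z) ≤ Real.Gamma (z + 1) := by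
    rw [Real.Gamma_eq_integral (by linarith), ← integral_exp_neg_Ioi, ← integral_const_mul]
    calc _ ≤ ∫ x in Set.Ioi z, Real.exp (-x) * x ^ (z + 1 - 1) := by
          refine setIntegral_mono_on ((integrableOn_exp_neg_Ioi z).const_mul _)
            (hconv.mono_set (Set.Ioi_subset_Ioi hz.le)) measurableSet_Ioi fun x hx ↦ ?_
          rw [add_sub_cancel_right, mul_comm]
          have := Real.rpow_le_rpow hz.le (Set.mem_Ioi.1 hx).le hz.le
          gcongr
      _ ≤ _ := by
          refine setIntegral_mono_set hconv ?_ (Set.Ioi_subset_Ioi hz.le).eventuallyLE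
          refine (ae_restrict_iff' measurableSet_Ioi).2 (ae_of_all _ fun x hx ↦ ?_)
          have : (0 : ℝ) < x := hx
          simp only [Pi.zero_apply]
          positivity
  have h := Real.log_le_log (by positivity) key
  rwa [Real.log_mul (by positivity) (by positivity), Real.log_rpow hz, Real.log_exp] at h

theorem log_sigmaSqHyp_eq {d k : ℕ} (hk : 1 < k) (hkd : k < d) (h : d + 1 < 2 * k) :
    Real.log (sigmaSqHyp d k) = ((d : ℝ) - k) / 2 * Real.log Real.pi +
      Real.log (Real.Gamma ((2 * (k : ℝ) - d - 1) / 2)) -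
      Real.log (Real.Gamma (((k : ℝ) - 1) / 2)) := by
  have h' : (d : ℝ) + 1 < 2 * k := by exact_mod_cast h
  have hk' : (1 : ℝ) < k := by exact_mod_cast hk
  have h1 := Real.Gamma_pos_of_pos (s := (2 * (k : ℝ) - d - 1) / 2) (by linarith)
  have h2 := Real.Gamma_pos_of_pos (s := ((k : ℝ) - 1) / 2) (by linarith)
  have h3 := Real.rpow_pos_of_pos Real.pi_pos (((d : ℝ) - k) / 2)
  rw [sigmaSqHyp_eq hk hkd h, Real.log_div (by positivity) (by positivity),
    Real.log_mul (by positivity) (by positivity), Real.log_rpow Real.pi_pos]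

theorem exponentBound_eq_exp {d k j : ℕ} (hk : 1 < k) (hkd : k < d) (h : d + 1 < 2 * k)
    (hj : (j : ℝ) < (2 * (k : ℝ) - d - 1) / 2) :
    exponentBound d k j = Real.exp (j *
      (Real.log ((((k : ℝ) - 1) / 2 - j) / ((2 * (k : ℝ) - d - 1) / 2 - j)) +
        Real.log (sigmaSqHyp d k) / ((k : ℝ) - 1))) := by
  have hkd' : (k : ℝ) < d := by exact_mod_cast hkd
  have h1 : 0 < (((k : ℝ) - 1) / 2 - j) / ((2 * (k : ℝ) - d - 1) / 2 - j) :=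
    div_pos (by linarith) (by linarith)
  rw [exponentBound, Real.rpow_def_of_pos (sigmaSqHyp_pos hk hkd h), mul_add, Real.exp_add,
    Real.exp_nat_mul, Real.exp_log h1]
  congr 2
  ring

/-- If `2k - d` grows linearly in `d`, the exponent bounds can be made arbitrarily small. -/
theorem exists_exponentBound_lt_of_linear {d k : ℕ → ℕ}
    (hadm : ∀ n, 1 ≤ k n ∧ k n + 1 ≤ d n ∧ d n + 1 < 2 * k n)
    (hd : Tendsto d atTop atTop) {c : ℝ} (hc : 1 / 2 < c)
    (hck : ∀ᶠ n in atTop, c < (k n : ℝ) / d n) {ε : ℝ} (hε : 0 < ε) :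
    ∀ᶠ n in atTop, ∃ j : ℕ, (j : ℝ) < (2 * (k n : ℝ) - d n - 1) / 2 ∧
      exponentBound (d n) (k n) j < ε := by
  have hd' : Tendsto (fun n ↦ (d n : ℝ)) atTop atTop := tendsto_natCast_atTop_atTop.comp hd
  obtain ⟨u, hu⟩ : ∃ u : ℝ, u = c - 1 / 2 := ⟨_, rfl⟩
  have hu0 : 0 < u := by linarith
  have hlin : ∀ᶠ n in atTop, u * d n ≤ 2 * (k n : ℝ) - d n - 1 := by
    filter_upwards [hck, hd'.eventually_ge_atTop (1 / u), hd'.eventually_gt_atTop 0]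
      with n h1 h2 h3
    rw [lt_div_iff₀ h3] at h1
    rw [div_le_iff₀ hu0] at h2
    nlinarith
  have hA : Tendsto (fun n ↦ (2 * (k n : ℝ) - d n - 1) / 2) atTop atTop :=
    Tendsto.atTop_div_const (by norm_num)
      (tendsto_atTop_mono' _ hlin (hd'.const_mul_atTop hu0))
  have hX : Tendsto (fun n ↦ Real.log ((2 * (k n : ℝ) - d n - 1) / 2 - 1)) atTop atTop :=
    Real.tendsto_log_atTop.comp (tendsto_atTop_add_const_right _ (-1) hA)
  filter_upwards [hlin, hA.eventually_ge_atTop 4,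
    hX.eventually_ge_atTop (4 / u + Real.log Real.pi),
    hX.eventually_ge_atTop (4 / u + Real.log Real.pi - 16 / u * (Real.log ε - 1))]
    with n hlin hA4 hX1 hX2
  obtain ⟨hk1, hkd, hdk⟩ := hadm n
  have hkd' : (k n : ℝ) + 1 ≤ d n := by exact_mod_cast hkd
  have hk2 : 1 < k n := by omega
  have hk2' : (1 : ℝ) < k n := by exact_mod_cast hk2
  obtain ⟨A, hAdef⟩ : ∃ A : ℝ, A = (2 * (k n : ℝ) - d n - 1) / 2 := ⟨_, rfl⟩
  obtain ⟨m, hm⟩ : ∃ m : ℝ, m = (k n : ℝ) - 1 := ⟨_, rfl⟩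
  obtain ⟨q, hq⟩ : ∃ q : ℝ, q = ((d n : ℝ) - k n) / 2 := ⟨_, rfl⟩
  rw [← hAdef] at hA4 hX1 hX2
  have hm0 : 0 < m := by linarith
  have hj1 : ((⌊A / 2⌋₊ : ℕ) : ℝ) ≤ A / 2 := Nat.floor_le (by linarith)
  have hj2 : A / 2 - 1 < ((⌊A / 2⌋₊ : ℕ) : ℝ) := Nat.sub_one_lt_floor _
  have hjA : ((⌊A / 2⌋₊ : ℕ) : ℝ) < A := by linarith
  refine ⟨⌊A / 2⌋₊, hAdef ▸ hjA, ?_⟩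
  rw [exponentBound_eq_exp hk2 (by omega) hdk (hAdef ▸ hjA), ← Real.lt_log_iff_exp_lt hε,
    log_sigmaSqHyp_eq hk2 (by omega) hdk, ← hm, ← hq, ← hAdef]
  generalize ((⌊A / 2⌋₊ : ℕ) : ℝ) = j at *
  have hmA : m / 2 = A + q := by rw [hm, hAdef, hq]; ring
  have hG := Real.log_Gamma_add_mul_log_le (x := A) (y := q) (by linarith) (by linarith)
  have hlog : Real.log ((m / 2 - j) / (A - j)) ≤ q / (A - j) := by
    refine (Real.log_le_sub_one_of_pos (div_pos (by linarith) (by linarith))).trans_eq ?_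
    rw [hmA]
    have : A - j ≠ 0 := by linarith
    field_simp
    ring
  have hmu : m * u ≤ 2 * A := by nlinarith
  have hmj : m / (A - j) ≤ 4 / u := by
    rw [div_le_div_iff₀ (by linarith) hu0]
    linarith
  obtain ⟨X, hXdef⟩ : ∃ X, X = 4 / u + Real.log Real.pi - Real.log (A - 1) := ⟨_, rfl⟩
  have hjm : u / 16 ≤ j * q / m := by
    rw [le_div_iff₀ hm0]
    nlinarith
  rw [hmA]
  calc j * (Real.log ((A + q - j) / (A - j)) + (q * Real.log Real.pi +
        Real.log (Real.Gamma A) - Real.log (Real.Gamma (A + q))) / m)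
      ≤ j * (q / (A - j) + (q * Real.log Real.pi - q * Real.log (A - 1)) / m) := by
        have hnum : q * Real.log Real.pi + Real.log (Real.Gamma A) -
            Real.log (Real.Gamma (A + q)) ≤ q * Real.log Real.pi - q * Real.log (A - 1) := by
          linarith
        rw [← hmA] at hnum ⊢
        gcongr
        linarith
    _ = j * q / m * (m / (A - j) + Real.log Real.pi - Real.log (A - 1)) := by
        field_simp
        ring
    _ ≤ j * q / m * X := by
        rw [hXdef]
        gcongr
        linarith
    _ ≤ u / 16 * X := mul_le_mul_of_nonpos_right hjm (by linarith)
    _ ≤ u / 16 * (16 / u * (Real.log ε - 1)) := by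
        gcongr
        linarith
    _ = Real.log ε - 1 := by field_simp
    _ < Real.log ε := by linarith

/-- In the regime `k/d → 1/2`, the exponent bounds can be made arbitrarily small as soon as
`(2k - d - 1)^(d/k)` eventually exceeds `c d` for some `c > eπ`. -/
theorem exists_exponentBound_lt_of_tendsto_half {d k : ℕ → ℕ}
    (hadm : ∀ n, 1 ≤ k n ∧ k n + 1 ≤ d n ∧ d n + 1 < 2 * k n)
    (hd : Tendsto d atTop atTop)
    (hkd : Tendsto (fun n ↦ (k n : ℝ) / (d n : ℝ)) atTop (nhds (1 / 2)))
    {c : ℝ} (hc : Real.exp 1 * Real.pi < c)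
    (hcond : ∀ᶠ n in atTop, c < ((d n : ℝ))⁻¹ *
      (2 * (k n : ℝ) - (d n : ℝ) - 1) ^ ((d n : ℝ) / (k n : ℝ))) {ε : ℝ} (hε : 0 < ε) :
    ∀ᶠ n in atTop, ∃ j : ℕ, (j : ℝ) < (2 * (k n : ℝ) - d n - 1) / 2 ∧
      exponentBound (d n) (k n) j < ε := by
  have hd' : Tendsto (fun n ↦ (d n : ℝ)) atTop atTop := tendsto_natCast_atTop_atTop.comp hd
  have hc1 : 1 < c := by
    have := Real.add_one_le_exp (1 : ℝ)
    nlinarith [Real.pi_gt_three]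
  have hd0 : ∀ n, (0 : ℝ) < d n := fun n ↦ by
    have := hadm n
    exact_mod_cast (by omega : 0 < d n)
  have hk0 : ∀ n, (1 : ℝ) < k n := fun n ↦ by
    have := hadm n
    exact_mod_cast (by omega : 1 < k n)
  have hdk : ∀ n, (d n : ℝ) + 2 ≤ 2 * k n := fun n ↦ by
    have := hadm n
    exact_mod_cast (by omega : d n + 2 ≤ 2 * k n)
  have hkd1 : ∀ n, (k n : ℝ) + 1 ≤ d n := fun n ↦ by exact_mod_cast (hadm n).2.1
  have hA : Tendsto (fun n ↦ (2 * (k n : ℝ) - d n - 1) / 2) atTop atTop := by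
    refine Tendsto.atTop_div_const (by norm_num) (tendsto_atTop_mono' _ ?_
      (Real.tendsto_sqrt_atTop.comp hd'))
    filter_upwards [hcond] with n hn
    refine Real.sqrt_le_iff.2 ⟨by linarith [hdk n], ?_⟩
    rw [lt_inv_mul_iff₀ (hd0 n)] at hn
    have h2 : (d n : ℝ) / k n ≤ 2 := by
      rw [div_le_iff₀ (by linarith [hk0 n])]
      linarith [hdk n]
    have h3 := Real.rpow_le_rpow_of_exponent_le (x := 2 * (k n : ℝ) - d n - 1)
      (by linarith [hdk n]) h2
    rw [Real.rpow_two] at h3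
    nlinarith [hd0 n]
  have hinv : Tendsto (fun n ↦ ((d n : ℝ))⁻¹) atTop (nhds 0) := tendsto_inv_atTop_zero.comp hd'
  have hM : Tendsto (fun n ↦ ((k n : ℝ) - 1) / 2) atTop atTop :=
    tendsto_atTop_mono (fun n ↦ by linarith [hkd1 n]) hA
  have hMd : Tendsto (fun n ↦ ((k n : ℝ) - 1) / 2 / d n) atTop (nhds (1 / 4)) := by
    have := (hkd.sub hinv).div_const 2
    convert this using 2 with n
    · have := (hd0 n).ne'
      field_simp
    · norm_num
  have hp : Tendsto (fun n ↦ (2 * (k n : ℝ) - d n - 1) / ((k n : ℝ) - 1)) atTop (nhds 0) := by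
    have := (((hkd.const_mul 2).sub_const 1).sub hinv).div (hkd.sub hinv) (by norm_num)
    convert this using 2 with n
    · have h1 := (hd0 n).ne'
      have h2 : (k n : ℝ) - 1 ≠ 0 := by linarith [hk0 n]
      have h3 : (k n : ℝ) / d n - (d n : ℝ)⁻¹ = ((k n : ℝ) - 1) / d n := by ring
      rw [Pi.div_apply, h3]
      field_simp
    · norm_num
  have hq : Tendsto (fun n ↦ ((d n : ℝ) - k n) / ((k n : ℝ) - 1)) atTop (nhds 1) := by
    have := (hkd.const_sub 1).div (hkd.sub hinv) (by norm_num)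
    convert this using 2 with n
    · have h1 := (hd0 n).ne'
      have h2 : (k n : ℝ) - 1 ≠ 0 := by linarith [hk0 n]
      have h3 : (k n : ℝ) / d n - (d n : ℝ)⁻¹ = ((k n : ℝ) - 1) / d n := by ring
      rw [Pi.div_apply, h3]
      field_simp
    · norm_num
  obtain ⟨δ, hδ⟩ : ∃ δ, δ = (Real.log c - Real.log (Real.exp 1 * Real.pi)) / 4 := ⟨_, rfl⟩
  have hpi := Real.pi_pos
  have hδ0 : 0 < δ := by
    have := Real.log_lt_log (by positivity) hc
    linarith
  obtain ⟨j, hj⟩ : ∃ j : ℕ, Real.exp (j * -δ) < ε := by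
    obtain ⟨j, hj⟩ := exists_nat_gt (-Real.log ε / δ)
    refine ⟨j, ?_⟩
    rw [← Real.lt_log_iff_exp_lt hε]
    rw [div_lt_iff₀ hδ0] at hj
    linarith
  have hlim : Tendsto (fun n ↦
      (Real.log (((k n : ℝ) - 1) / 2 / d n) - Real.log c +
        (2 - (2 * (k n : ℝ) - d n - 1) / ((k n : ℝ) - 1)) * Real.log 2 +
        ((d n : ℝ) - k n) / ((k n : ℝ) - 1) * Real.log Real.pi + 1) / 2
      - Real.log (1 - j / ((2 * (k n : ℝ) - d n - 1) / 2))
      - Real.log (1 - 1 / (((k n : ℝ) - 1) / 2)) / 2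
      + Real.log (((k n : ℝ) - 1) / 2) / (((k n : ℝ) - 1) / 2) / 2) atTop (nhds (-2 * δ)) := by
    have h1 := hMd.log (by norm_num)
    have h2 := (hp.const_sub 2).mul_const (Real.log 2)
    have h3 := hq.mul_const (Real.log Real.pi)
    have h4 := ((hA.const_div_atTop (j : ℝ)).const_sub 1).log (by norm_num)
    have h5 := ((hM.const_div_atTop (1 : ℝ)).const_sub 1).log (by norm_num)
    have h6 : Tendsto (fun n ↦ Real.log (((k n : ℝ) - 1) / 2) / (((k n : ℝ) - 1) / 2)) atTop
        (nhds 0) := Real.isLittleO_log_id_atTop.tendsto_div_nhds_zero.comp hM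
    have := ((((((h1.sub_const (Real.log c)).add h2).add h3).add_const 1).div_const 2).sub
      h4).sub (h5.div_const 2) |>.add (h6.div_const 2)
    convert this using 2
    rw [hδ, Real.log_mul (by positivity) (by positivity), Real.log_exp,
      show (1 / 4 : ℝ) = (2 ^ 2)⁻¹ by norm_num, Real.log_inv, Real.log_pow]
    simp
    ring
  filter_upwards [hcond, hlim.eventually_lt_const (show -2 * δ < -δ by linarith),
    hA.eventually_gt_atTop (j : ℝ), hA.eventually_gt_atTop 1] with n hn hF hjA hA1
  have hk2 : 1 < k n := by exact_mod_cast hk0 n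
  have hkd2 : k n < d n := (hadm n).2.1
  refine ⟨j, hjA, lt_of_le_of_lt ?_ hj⟩
  rw [exponentBound_eq_exp hk2 hkd2 (hadm n).2.2 hjA, log_sigmaSqHyp_eq hk2 hkd2 (hadm n).2.2]
  refine Real.exp_le_exp.2 (mul_le_mul_of_nonneg_left (le_trans ?_ hF.le) (by positivity))
  have hlogc : Real.log c + Real.log (d n) ≤
      (d n : ℝ) / k n * Real.log (2 * (k n : ℝ) - d n - 1) := by
    rw [lt_inv_mul_iff₀ (hd0 n)] at hn
    have hdn := hd0 n
    have := Real.log_le_log (by positivity) hn.le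
    rw [Real.log_mul (by positivity) (by positivity),
      Real.log_rpow (by linarith [hdk n])] at this
    linarith
  have hexp : (d n : ℝ) / k n ≤ 2 - (2 * (k n : ℝ) - d n - 1) / ((k n : ℝ) - 1) := by
    have h1 : (0 : ℝ) < (k n : ℝ) - 1 := by linarith [hk0 n]
    rw [show 2 - (2 * (k n : ℝ) - d n - 1) / ((k n : ℝ) - 1) = ((d n : ℝ) - 1) / ((k n : ℝ) - 1) by
      field_simp; ring, div_le_div_iff₀ (by linarith) h1]
    linarith [hkd1 n]
  have hkn := hkd1 n
  have hdn := hd0 n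
  obtain ⟨A, hAdef⟩ : ∃ A : ℝ, A = (2 * (k n : ℝ) - d n - 1) / 2 := ⟨_, rfl⟩
  obtain ⟨M, hMdef⟩ : ∃ M : ℝ, M = ((k n : ℝ) - 1) / 2 := ⟨_, rfl⟩
  obtain ⟨q, hqdef⟩ : ∃ q : ℝ, q = ((d n : ℝ) - k n) / 2 := ⟨_, rfl⟩
  have e1 : 2 * (k n : ℝ) - d n - 1 = 2 * A := by linarith
  have e2 : (k n : ℝ) - 1 = 2 * M := by linarith
  have e3 : (d n : ℝ) - k n = 2 * q := by linarith
  have hMA : M = A + q := by linarith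
  have hq0 : 0 < q := by linarith
  rw [e1] at hlogc hexp hjA hA1
  rw [e2] at hexp
  rw [e1, e2, e3]
  simp only [mul_div_cancel_left₀ _ (two_ne_zero : (2 : ℝ) ≠ 0),
    mul_div_mul_left _ _ (two_ne_zero : (2 : ℝ) ≠ 0)] at hexp hjA hA1 ⊢
  have hM0 : 0 < M := by linarith
  have hG1 := Real.log_Gamma_le_mul_log hA1.le
  have hG2 := Real.mul_log_sub_le_log_Gamma_add_one (z := M - 1) (by linarith)
  rw [sub_add_cancel] at hG2
  have hlogA : 0 ≤ Real.log (2 * A) := Real.log_nonneg (by linarith)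
  have hlog2A : Real.log (2 * A) = Real.log 2 + Real.log A :=
    Real.log_mul (by norm_num) (by linarith)
  have hkey : Real.log c + Real.log (d n) ≤ (2 - A / M) * (Real.log 2 + Real.log A) := by
    rw [← hlog2A]
    exact hlogc.trans (mul_le_mul_of_nonneg_right hexp hlogA)
  have hratio : Real.log ((M - j) / (A - j)) ≤
      Real.log M - Real.log A - Real.log (1 - j / A) := by
    have : (1 : ℝ) - j / A = (A - j) / A := by field_simp
    rw [this, Real.log_div (by linarith) (by linarith), Real.log_div (by linarith) (by linarith)]
    have := Real.log_le_log (x := M - j) (y := M) (by linarith)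
      (by linarith [(Nat.cast_nonneg j : (0 : ℝ) ≤ j)])
    linarith
  have hlogM1 : Real.log (1 - 1 / M) = Real.log (M - 1) - Real.log M := by
    rw [← Real.log_div (by linarith) (by linarith)]
    congr 1
    field_simp
  have hlogMle : Real.log (M - 1) ≤ Real.log M := Real.log_le_log (by linarith) (by linarith)
  have hS : (q * Real.log Real.pi + Real.log (Real.Gamma A) - Real.log (Real.Gamma M)) / (2 * M) ≤
      q / M * Real.log Real.pi / 2 + A / M * Real.log A / 2 - Real.log (M - 1) / 2
        + Real.log M / M / 2 + 1 / 2 := by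
    rw [div_le_iff₀ (by positivity)]
    have : (q / M * Real.log Real.pi / 2 + A / M * Real.log A / 2 - Real.log (M - 1) / 2
        + Real.log M / M / 2 + 1 / 2) * (2 * M) =
        q * Real.log Real.pi + A * Real.log A - M * Real.log (M - 1) + Real.log M + M := by
      field_simp
    rw [this]
    linarith
  rw [Real.log_div hM0.ne' hdn.ne']
  linarith

/-- Degenerate high-dimensional limit: if `(d_n,k_n)` is admissible, `d_n → ∞`, and either
(i) `k_n/d_n → 1/2` with `liminf d_n⁻¹ (2k_n−d_n−1)^{d_n/k_n} > eπ`, or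
(ii) `liminf k_n/d_n > 1/2`, then the probability measures `μ n` with characteristic function
`exp(∫_0^1 (e^{itx/σ_{d_n,k_n}} − 1 − itx/σ_{d_n,k_n}) f_{d_n,k_n}(x) dx)`
converge weakly to the Dirac measure at `0`. -/
theorem hyperbolic_degenerate_limit (d k : ℕ → ℕ)
    (hadm : ∀ n, 1 ≤ k n ∧ k n + 1 ≤ d n ∧ d n + 1 < 2 * k n)
    (hd : Tendsto d atTop atTop)
    (hcond :
      (Tendsto (fun n => (k n : ℝ) / (d n : ℝ)) atTop (nhds (1 / 2)) ∧
        ((Real.exp 1 * Real.pi : ℝ) : EReal) <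
          Filter.liminf
            (fun n => (((d n : ℝ))⁻¹ *
              (2 * (k n : ℝ) - (d n : ℝ) - 1) ^ ((d n : ℝ) / (k n : ℝ)) : ℝ) : ℕ → EReal)
            atTop) ∨
      (1 / 2 : EReal) <
        Filter.liminf (fun n => (((k n : ℝ) / (d n : ℝ) : ℝ) : EReal)) atTop)
    (μ : ℕ → ProbabilityMeasure ℝ)
    (hchar : ∀ n, ∀ t : ℝ, charFn (μ n) t =
      Complex.exp (∫ x in Set.Ioo (0 : ℝ) 1,
        (Complex.exp (Complex.I * t * (x / sigmaHyp (d n) (k n))) - 1 -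
            Complex.I * t * (x / sigmaHyp (d n) (k n))) *
          (levyDensity (d n) (k n) x : ℂ))) :
    Tendsto μ atTop (nhds ⟨Measure.dirac 0, inferInstance⟩) := by
  have hsmall : ∀ ε : ℝ, 0 < ε → ∀ᶠ n in atTop, ∃ j : ℕ,
      (j : ℝ) < (2 * (k n : ℝ) - d n - 1) / 2 ∧ exponentBound (d n) (k n) j < ε := by
    intro ε hε
    rcases hcond with ⟨hhalf, hlim⟩ | hlim
    · obtain ⟨c, hc1, hc2⟩ := EReal.lt_iff_exists_real_btwn.1 hlim
      refine exists_exponentBound_lt_of_tendsto_half hadm hd hhalf (EReal.coe_lt_coe_iff.1 hc1)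
        ((eventually_lt_of_lt_liminf hc2).mono fun n hn ↦ ?_) hε
      exact EReal.coe_lt_coe_iff.1 hn
    · obtain ⟨c, hc1, hc2⟩ := EReal.lt_iff_exists_real_btwn.1 hlim
      have hc : (1 / 2 : ℝ) < c := by
        have h2 : (1 / 2 : EReal) = ((1 / 2 : ℝ) : EReal) := by
          rw [EReal.coe_div]
          norm_cast
        rw [h2] at hc1
        exact EReal.coe_lt_coe_iff.1 hc1
      exact exists_exponentBound_lt_of_linear hadm hd hc
        ((eventually_lt_of_lt_liminf hc2).mono fun n hn ↦ EReal.coe_lt_coe_iff.1 hn) hε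
  refine ProbabilityMeasure.tendsto_iff_tendsto_charFun.2 fun t ↦ ?_
  have hμ : ∀ n, charFun (μ n : Measure ℝ) t = Complex.exp (∫ x in Set.Ioo (0 : ℝ) 1,
        (Complex.exp (Complex.I * t * (x / sigmaHyp (d n) (k n))) - 1 -
            Complex.I * t * (x / sigmaHyp (d n) (k n))) *
          (levyDensity (d n) (k n) x : ℂ)) := fun n ↦ by
    rw [← hchar n t, charFun_apply_real, charFn]
    refine integral_congr_ae (ae_of_all _ fun x ↦ ?_)
    ring_nf
  have hdirac : charFun (Measure.dirac (0 : ℝ)) t = Complex.exp 0 := by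
    simp
  simp only [hμ, ProbabilityMeasure.coe_mk, hdirac]
  refine (Complex.continuous_exp.tendsto 0).comp ?_
  rw [Metric.tendsto_nhds]
  intro ε hε
  have ht : 0 < 2 * (1 + |t|) ^ 2 := by positivity
  filter_upwards [hsmall (ε / (2 * (1 + |t|) ^ 2)) (by positivity)] with n ⟨j, hj, hb⟩
  obtain ⟨h1, h2, h3⟩ := hadm n
  rw [dist_zero_right]
  refine (norm_characteristicExponent_le (by omega) (by omega) h3 hj t).trans_lt ?_
  rwa [lt_div_iff₀' ht] at hb
end

section
/- Let (μ_n) be a sequence of probability measures on ℝ and (ν_n) a sequence of (Borel) measures on ℝ such that for every n, the characteristic function of μ_n satisfies φ_n(t) = exp( ∫_ℝ (e^{itx} − 1 − itx) ν_n(dx) ) for all t ∈ ℝ, and ∫_ℝ x² ν_n(dx) = 1. If for every ε > 0 one has ∫_{|x| > ε} x² ν_n(dx) → 0 as n → ∞, then μ_n converges weakly to the standard Gaussian measure N(0,1) on ℝ. -/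
open MeasureTheory ProbabilityTheory Filter

/-- The second-order Taylor remainder of `y ↦ exp (i y)` is bounded by both the square and the
cube of `|y|`. -/
lemma norm_exp_I_mul_taylor_two_le (y : ℝ) :
    ‖Complex.exp (Complex.I * y) - 1 - Complex.I * y + (y : ℂ) ^ 2 / 2‖ ≤ 4 * y ^ 2 ∧
    ‖Complex.exp (Complex.I * y) - 1 - Complex.I * y + (y : ℂ) ^ 2 / 2‖ ≤ 4 * |y| ^ 3 := by
  rw [← sq_abs y]
  have habs : 0 ≤ |y| := abs_nonneg y
  rcases le_total |y| 1 with h | h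
  · have key := Complex.norm_exp_sub_sum_le_norm_mul_exp (Complex.I * y) 3
    have hsum : Complex.exp (Complex.I * y) - ∑ m ∈ Finset.range 3,
        (Complex.I * y) ^ m / (m.factorial : ℂ) =
        Complex.exp (Complex.I * y) - 1 - Complex.I * y + (y : ℂ) ^ 2 / 2 := by
      simp [Finset.sum_range_succ, Nat.factorial, mul_pow]
      ring
    rw [hsum] at key
    have hnorm : ‖Complex.I * (y : ℂ)‖ = |y| := by simp
    rw [hnorm] at key
    have hexp : Real.exp |y| ≤ 4 :=
      (Real.exp_le_exp.2 h).trans (by linarith [Real.exp_one_lt_d9])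
    have hcube : |y| ^ 3 * Real.exp |y| ≤ 4 * |y| ^ 3 := by
      rw [mul_comm]
      gcongr
    have hpow : |y| ^ 3 ≤ |y| ^ 2 := pow_le_pow_of_le_one habs h (by norm_num)
    exact ⟨by linarith, by linarith⟩
  · have hpow : |y| ^ 2 ≤ |y| ^ 3 := pow_le_pow_right₀ h (by norm_num)
    have hbound : ‖Complex.exp (Complex.I * y) - 1 - Complex.I * y + (y : ℂ) ^ 2 / 2‖ ≤
        1 + 1 + |y| + |y| ^ 2 / 2 := by
      refine (norm_add_le _ _).trans (add_le_add ((norm_sub_le _ _).trans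
        (add_le_add ((norm_sub_le _ _).trans (add_le_add ?_ ?_)) ?_)) ?_)
      · rw [Complex.norm_exp_I_mul_ofReal]
      · simp
      · simp
      · simp
    exact ⟨by nlinarith, by nlinarith⟩

/-- The Kolmogorov exponent of a measure with unit second moment differs from the Gaussian
exponent by a small multiple of `ε` plus a multiple of the second moment outside `[-ε, ε]`. -/
lemma norm_kolmogorov_exponent_add_le {ν : Measure ℝ} (hvar : ∫ x : ℝ, x ^ 2 ∂ν = 1)
    (t : ℝ) {ε : ℝ} (hε : 0 < ε) :
    ‖(∫ x : ℝ, (Complex.exp (Complex.I * t * x) - 1 - Complex.I * t * x) ∂ν) +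
      (t : ℂ) ^ 2 / 2‖ ≤
      4 * |t| ^ 3 * ε + 4 * t ^ 2 * ∫ x in {x : ℝ | ε < |x|}, x ^ 2 ∂ν := by
  have hint : Integrable (fun x : ℝ ↦ x ^ 2) ν := by
    by_contra h
    rw [integral_undef h] at hvar
    exact zero_ne_one hvar
  have hS : MeasurableSet {x : ℝ | ε < |x|} := measurableSet_lt measurable_const measurable_norm
  set g : ℝ → ℂ := fun x ↦
    Complex.exp (Complex.I * t * x) - 1 - Complex.I * t * x + (t : ℂ) ^ 2 / 2 * ((x ^ 2 : ℝ) : ℂ)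
    with hg
  have hg_bound (x : ℝ) : ‖g x‖ ≤ 4 * (t * x) ^ 2 ∧ ‖g x‖ ≤ 4 * |t * x| ^ 3 := by
    have hgx : g x = Complex.exp (Complex.I * (t * x : ℝ)) - 1 - Complex.I * (t * x : ℝ) +
        ((t * x : ℝ) : ℂ) ^ 2 / 2 := by
      simp only [hg]
      push_cast
      ring_nf
    rw [hgx]
    exact norm_exp_I_mul_taylor_two_le (t * x)
  have hg_int : Integrable g ν := by
    refine (hint.const_mul (4 * t ^ 2)).mono' ?_ (ae_of_all _ fun x ↦ ?_)
    · exact (by fun_prop : Continuous g).aestronglyMeasurable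
    · exact (hg_bound x).1.trans_eq (by ring)
  have hsq_int : Integrable (fun x : ℝ ↦ (t : ℂ) ^ 2 / 2 * ((x ^ 2 : ℝ) : ℂ)) ν :=
    hint.ofReal.const_mul _
  have heq : (∫ x : ℝ, (Complex.exp (Complex.I * t * x) - 1 - Complex.I * t * x) ∂ν) +
      (t : ℂ) ^ 2 / 2 = ∫ x, g x ∂ν := by
    have hsub : (fun x : ℝ ↦ Complex.exp (Complex.I * t * x) - 1 - Complex.I * t * x) =
        fun x ↦ g x - (t : ℂ) ^ 2 / 2 * ((x ^ 2 : ℝ) : ℂ) := by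
      ext x
      simp [hg]
    rw [hsub, integral_sub hg_int hsq_int, integral_const_mul, integral_complex_ofReal, hvar]
    simp
  have htail_int : Integrable ({x : ℝ | ε < |x|}.indicator fun x ↦ x ^ 2) ν := hint.indicator hS
  rw [heq]
  calc ‖∫ x, g x ∂ν‖
      ≤ ∫ x, (4 * |t| ^ 3 * ε * x ^ 2 +
          4 * t ^ 2 * {x : ℝ | ε < |x|}.indicator (fun x ↦ x ^ 2) x) ∂ν := by
        refine norm_integral_le_of_norm_le
          ((hint.const_mul _).add (htail_int.const_mul _)) (ae_of_all _ fun x ↦ ?_)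
        by_cases hx : ε < |x|
        · rw [Set.indicator_of_mem (show x ∈ {x : ℝ | ε < |x|} from hx)]
          have : 0 ≤ 4 * |t| ^ 3 * ε * x ^ 2 := by positivity
          linarith [(hg_bound x).1, mul_pow t x 2]
        · rw [Set.indicator_of_notMem (show x ∉ {x : ℝ | ε < |x|} from hx), mul_zero, add_zero]
          refine (hg_bound x).2.trans ?_
          have hx' : |x| ≤ ε := not_lt.1 hx
          calc 4 * |t * x| ^ 3 = 4 * |t| ^ 3 * |x| * x ^ 2 := by
                rw [abs_mul, ← sq_abs x]; ring
            _ ≤ 4 * |t| ^ 3 * ε * x ^ 2 := by gcongr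
    _ = 4 * |t| ^ 3 * ε + 4 * t ^ 2 * ∫ x in {x : ℝ | ε < |x|}, x ^ 2 ∂ν := by
        rw [integral_add (hint.const_mul _) (htail_int.const_mul _), integral_const_mul,
          integral_const_mul, hvar, integral_indicator hS, mul_one]

/-- If probability measures `μ n` have characteristic functions of Kolmogorov form with
Lévy measures `ν n` of unit second moment, and the second moment of `ν n` outside any
neighbourhood of zero vanishes asymptotically, then `μ n` converges weakly to `N(0,1)`. -/
theorem clt_of_levy_tail_vanishes
    (μ : ℕ → ProbabilityMeasure ℝ) (ν : ℕ → Measure ℝ)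
    (hchar : ∀ n, ∀ t : ℝ, charFn (μ n) t =
      Complex.exp (∫ x : ℝ,
        (Complex.exp (Complex.I * t * x) - 1 - Complex.I * t * x) ∂(ν n)))
    (hvar : ∀ n, ∫ x : ℝ, x ^ 2 ∂(ν n) = 1)
    (htail : ∀ ε : ℝ, 0 < ε →
      Tendsto (fun n => ∫ x in {x : ℝ | ε < |x|}, x ^ 2 ∂(ν n)) atTop (nhds 0)) :
    Tendsto μ atTop (nhds ⟨gaussianReal 0 1, inferInstance⟩) := by
  refine ProbabilityMeasure.tendsto_iff_tendsto_charFun.2 fun t ↦ ?_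
  have hcharFun (n : ℕ) : charFun (μ n : Measure ℝ) t = Complex.exp (∫ x : ℝ,
      (Complex.exp (Complex.I * t * x) - 1 - Complex.I * t * x) ∂(ν n)) := by
    rw [← hchar n t, charFun_apply_real, charFn]
    congr with x
    ring_nf
  have hgauss : charFun (gaussianReal 0 1) t = Complex.exp (-((t : ℂ) ^ 2 / 2)) := by
    rw [charFun_gaussianReal]
    simp
  simp_rw [hcharFun]
  change Tendsto _ atTop (nhds (charFun (gaussianReal 0 1) t))
  rw [hgauss]
  refine (Complex.continuous_exp.tendsto _).comp ?_
  rw [Metric.tendsto_nhds]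
  intro δ hδ
  set ε : ℝ := δ / (2 * (4 * |t| ^ 3 + 1)) with hε_def
  have hε : 0 < ε := by positivity
  have hlim : Tendsto (fun n ↦ 4 * |t| ^ 3 * ε +
      4 * t ^ 2 * ∫ x in {x : ℝ | ε < |x|}, x ^ 2 ∂(ν n)) atTop (nhds (4 * |t| ^ 3 * ε)) := by
    simpa using ((htail ε hε).const_mul (4 * t ^ 2)).const_add (4 * |t| ^ 3 * ε)
  have hlt : 4 * |t| ^ 3 * ε < δ := by
    have hmul : ε * (2 * (4 * |t| ^ 3 + 1)) = δ := div_mul_cancel₀ _ (by positivity)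
    have : 0 ≤ |t| ^ 3 * ε := by positivity
    linarith
  filter_upwards [hlim.eventually_lt_const hlt] with n hn
  rw [dist_eq_norm, sub_neg_eq_add]
  exact (norm_kolmogorov_exponent_add_le (hvar n) t hε).trans_lt hn
end
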